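/- Fix an integer N ≥ 1, a ∈ ℤ^g and c, x ∈ ℂ^g. For z ∈ ℂ^g with θ(z) ≠ 0 define the Baker–Akhiezer function ψ(z) = [f_{N,a}(z + (c+x)/N) / θ(z)^N] · exp(−∑_{i=1}^g x_i ζ_i(z)). Then for all m, n ∈ ℤ^g and every z with θ(z) ≠ 0, ψ(z + m + Ωn) = exp(−2πi nᵀc) · ψ(z). (This is the paper's claim that, as a function of z, any generator of the Baker–Akhiezer module M_c satisfies the equation (Lc), independently of the deformation parameters x.) -/

import Mathlib

open Matrix

open scoped Matrix

/-- The Riemann theta function with characteristic `(a,b)`: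
`θ_{a,b}(z,Ω) = ∑_{n∈ℤ^g} exp(πi (n+a)ᵀΩ(n+a) + 2πi (n+a)ᵀ(z+b))`. -/
noncomputable def riemannThetaChar {g : ℕ} (Ω : Matrix (Fin g) (Fin g) ℂ)
    (a b : Fin g → ℝ) (z : Fin g → ℂ) : ℂ :=
  ∑' n : Fin g → ℤ,
    Complex.exp ((Real.pi : ℂ) * Complex.I *
        ((fun i => (n i : ℂ) + (a i : ℂ)) ⬝ᵥ
          Ω.mulVec (fun i => (n i : ℂ) + (a i : ℂ))) +
      2 * (Real.pi : ℂ) * Complex.I *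
        ((fun i => (n i : ℂ) + (a i : ℂ)) ⬝ᵥ (fun i => z i + (b i : ℂ))))

/-- `f_{N,a}(z) = θ_{a/N,0}(Nz, NΩ)`. -/
noncomputable def fTheta {g : ℕ} (Ω : Matrix (Fin g) (Fin g) ℂ) (N : ℕ)
    (a : Fin g → ℤ) (z : Fin g → ℂ) : ℂ :=
  riemannThetaChar ((N : ℂ) • Ω) (fun i => (a i : ℝ) / (N : ℝ)) 0
    (fun i => (N : ℂ) * z i)

/-- `ζ_j(z) = (∂θ/∂z_j)(z) / θ(z)`, the `j`-th logarithmic derivative of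
`θ = θ_{0,0}(·,Ω)`. -/
noncomputable def zetaTheta {g : ℕ} (Ω : Matrix (Fin g) (Fin g) ℂ) (j : Fin g)
    (z : Fin g → ℂ) : ℂ :=
  fderiv ℂ (riemannThetaChar Ω 0 0) z (Pi.single j 1) / riemannThetaChar Ω 0 0 z

/-- A product of nonnegative summable functions of the separate coordinates is summable. -/
theorem summable_prod_apply_of_nonneg {g : ℕ} {α : Type*} {b : α → ℝ} (hb : Summable b)
    (hb0 : 0 ≤ b) : Summable fun n : Fin g → α => ∏ i, b (n i) := by
  induction g with
  | zero => exact Summable.of_finite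
  | succ g ih =>
    rw [← (Fin.consEquiv fun _ : Fin (g + 1) => α).summable_iff]
    refine (hb.mul_of_nonneg ih hb0 fun n => Finset.prod_nonneg fun i _ => hb0 _).congr
      fun p => ?_
    simp [Fin.consEquiv, Fin.prod_univ_succ]

/-- A positive definite real quadratic form dominates a positive multiple of the sum of squares. -/
theorem Matrix.PosDef.exists_mul_sum_sq_le {ι : Type*} [Fintype ι] {Y : Matrix ι ι ℝ}
    (hY : Y.PosDef) : ∃ t > 0, ∀ v : ι → ℝ, t * ∑ i, v i ^ 2 ≤ v ⬝ᵥ Y.mulVec v := by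
  have hcont : Continuous fun v : EuclideanSpace ℝ ι => v.ofLp ⬝ᵥ Y.mulVec v.ofLp := by
    fun_prop
  rcases (Metric.sphere (0 : EuclideanSpace ℝ ι) 1).eq_empty_or_nonempty with hS | hS
  · refine ⟨1, one_pos, fun v => ?_⟩
    have hv : v = 0 := by
      by_contra hv
      have h0 : WithLp.toLp 2 v ≠ 0 := by simpa using hv
      exact Set.eq_empty_iff_forall_notMem.1 hS (‖WithLp.toLp 2 v‖⁻¹ • WithLp.toLp 2 v)
        (mem_sphere_zero_iff_norm.2 (norm_smul_inv_norm (𝕜 := ℝ) h0))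
    simp [hv]
  · obtain ⟨w, hw, hmin⟩ := (isCompact_sphere (0 : EuclideanSpace ℝ ι) 1).exists_isMinOn hS
      hcont.continuousOn
    have hw0 : w.ofLp ≠ 0 := by
      intro h
      have : w = 0 := by ext i; simp [h]
      simp [this] at hw
    refine ⟨w.ofLp ⬝ᵥ Y.mulVec w.ofLp, by simpa using hY.dotProduct_mulVec_pos hw0, fun v => ?_⟩
    by_cases hv : v = 0
    · simp [hv]
    have h0 : WithLp.toLp 2 v ≠ 0 := by simpa using hv
    have hn : 0 < ‖WithLp.toLp 2 v‖ := norm_pos_iff.2 h0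
    have key := hmin (a := ‖WithLp.toLp 2 v‖⁻¹ • WithLp.toLp 2 v)
      (mem_sphere_zero_iff_norm.2 (norm_smul_inv_norm (𝕜 := ℝ) h0))
    simp only [Set.mem_ofPred_eq, WithLp.ofLp_smul, mulVec_smul, dotProduct_smul, smul_dotProduct,
      smul_eq_mul] at key
    have hsq : ∑ i, v i ^ 2 = ‖WithLp.toLp 2 v‖ ^ 2 := by
      simp [EuclideanSpace.norm_sq_eq]
    rw [hsq]
    calc _ ≤ _ := mul_le_mul_of_nonneg_right key (sq_nonneg _)
      _ = _ := by field_simp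

/-- Symmetric bilinear forms: the quadratic form of a sum. -/
theorem Matrix.IsSymm.add_dotProduct_mulVec_add {ι R : Type*} [Fintype ι] [CommRing R]
    {Ω : Matrix ι ι R} (hΩ : Ω.IsSymm) (u v : ι → R) :
    (u + v) ⬝ᵥ Ω.mulVec (u + v) =
      u ⬝ᵥ Ω.mulVec u + 2 * (u ⬝ᵥ Ω.mulVec v) + v ⬝ᵥ Ω.mulVec v := by
  have h : v ⬝ᵥ Ω.mulVec u = u ⬝ᵥ Ω.mulVec v := by
    rw [dotProduct_mulVec, dotProduct_comm, ← mulVec_transpose, hΩ.eq]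
  rw [mulVec_add, add_dotProduct, dotProduct_add, dotProduct_add, h]
  ring

theorem exp_two_pi_I_mul_intCast_dotProduct {g : ℕ} (k m : Fin g → ℤ) :
    Complex.exp (2 * (Real.pi : ℂ) * Complex.I *
      ((fun i => (k i : ℂ)) ⬝ᵥ fun i => (m i : ℂ))) = 1 := by
  rw [Complex.exp_eq_one_iff]
  exact ⟨k ⬝ᵥ m, by simp only [dotProduct]; push_cast; ring⟩

/-- Quasi-periodicity of the theta function with characteristic `(a,0)`. -/
theorem riemannThetaChar_add_period {g : ℕ} {Ω : Matrix (Fin g) (Fin g) ℂ} (hΩ : Ω.IsSymm)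
    (a : Fin g → ℝ) (m n : Fin g → ℤ) (z : Fin g → ℂ) :
    riemannThetaChar Ω a 0 (fun i => z i + (m i : ℂ) + Ω.mulVec (fun l => (n l : ℂ)) i) =
      Complex.exp (2 * (Real.pi : ℂ) * Complex.I * ((fun i => (a i : ℂ)) ⬝ᵥ fun i => (m i : ℂ)) -
        (Real.pi : ℂ) * Complex.I *
          ((fun i => (n i : ℂ)) ⬝ᵥ Ω.mulVec fun i => (n i : ℂ)) -
        2 * (Real.pi : ℂ) * Complex.I * ((fun i => (n i : ℂ)) ⬝ᵥ z)) *
        riemannThetaChar Ω a 0 z := by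
  unfold riemannThetaChar
  rw [← tsum_mul_left]
  refine Eq.trans (tsum_congr fun k => ?_) ((Equiv.addRight n).tsum_eq _)
  set u : Fin g → ℂ := fun i => (k i : ℂ) + (a i : ℂ) with hu
  set v : Fin g → ℂ := fun i => (n i : ℂ) with hv
  have huv : (fun i => (((Equiv.addRight n) k i : ℤ) : ℂ) + (a i : ℂ)) = u + v := by
    ext i
    simp [hu, hv]
    ring
  have hz : (fun i => z i + (((0 : Fin g → ℝ) i : ℝ) : ℂ)) = z := by ext i; simp
  have hz' : (fun i => z i + (m i : ℂ) + Ω.mulVec v i + (((0 : Fin g → ℝ) i : ℝ) : ℂ)) =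
      z + (fun i => (m i : ℂ)) + Ω.mulVec v := by ext i; simp
  have hum : u ⬝ᵥ (fun i => (m i : ℂ)) = ((fun i => (k i : ℂ)) ⬝ᵥ fun i => (m i : ℂ)) +
      ((fun i => (a i : ℂ)) ⬝ᵥ fun i => (m i : ℂ)) := by
    rw [← add_dotProduct]; rfl
  rw [huv, hz, hz', hΩ.add_dotProduct_mulVec_add, add_dotProduct, dotProduct_add, dotProduct_add,
    hum, ← Complex.exp_add, ← mul_one (Complex.exp (_ - _ - _ + _)),
    ← exp_two_pi_I_mul_intCast_dotProduct k m, ← Complex.exp_add]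
  congr 1
  ring

/-- The terms of the theta series are bounded by a product of Gaussians. -/
theorem norm_exp_riemannTheta_term_le {g : ℕ} {Ω : Matrix (Fin g) (Fin g) ℂ} {t R : ℝ}
    (ht : ∀ v : Fin g → ℝ, t * ∑ i, v i ^ 2 ≤
      v ⬝ᵥ (Matrix.of fun i j => (Ω i j).im : Matrix (Fin g) (Fin g) ℝ).mulVec v)
    (n : Fin g → ℤ) {z : Fin g → ℂ} (hz : ‖z‖ ≤ R) :
    ‖Complex.exp ((Real.pi : ℂ) * Complex.I *
        ((fun i => (n i : ℂ)) ⬝ᵥ Ω.mulVec (fun i => (n i : ℂ))) +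
      2 * (Real.pi : ℂ) * Complex.I * ((fun i => (n i : ℂ)) ⬝ᵥ z))‖ ≤
      ∏ i, Real.exp (-Real.pi * (t * (n i : ℝ) ^ 2 - 2 * R * |(n i : ℝ)|)) := by
  rw [Complex.norm_exp, ← Real.exp_sum, Real.exp_le_exp, ← Finset.mul_sum]
  have h1 : ((fun i => (n i : ℂ)) ⬝ᵥ Ω.mulVec (fun i => (n i : ℂ))).im =
      (fun i => (n i : ℝ)) ⬝ᵥ (Matrix.of fun i j => (Ω i j).im :
        Matrix (Fin g) (Fin g) ℝ).mulVec (fun i => (n i : ℝ)) := by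
    simp [dotProduct, mulVec]
  have h2 : -∑ i, R * |(n i : ℝ)| ≤ ((fun i => (n i : ℂ)) ⬝ᵥ z).im := by
    simp only [dotProduct, Complex.im_sum, ← Finset.sum_neg_distrib]
    refine Finset.sum_le_sum fun i _ => ?_
    have h3 : |(z i).im| ≤ R := ((z i).abs_im_le_norm.trans (norm_le_pi_norm z i)).trans hz
    have h4 : ((n i : ℂ) * z i).im = n i * (z i).im := by simp
    rw [h4]
    have h5 := neg_abs_le ((n i : ℝ) * (z i).im)
    rw [abs_mul] at h5
    nlinarith [abs_nonneg (n i : ℝ)]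
  have hre (w w' : ℂ) : ((Real.pi : ℂ) * Complex.I * w + 2 * (Real.pi : ℂ) * Complex.I * w').re =
      -Real.pi * (w.im + 2 * w'.im) := by
    simp
    ring
  rw [hre, h1]
  have h6 := ht fun i => (n i : ℝ)
  have h7 : ∑ i, (t * (n i : ℝ) ^ 2 - 2 * R * |(n i : ℝ)|) =
      t * ∑ i, (n i : ℝ) ^ 2 - 2 * ∑ i, R * |(n i : ℝ)| := by
    simp only [Finset.sum_sub_distrib, Finset.mul_sum, mul_assoc]
  rw [h7, neg_mul, neg_mul, neg_le_neg_iff]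
  exact mul_le_mul_of_nonneg_left (by linarith) Real.pi_pos.le

/-- The Riemann theta function is entire. -/
theorem differentiableAt_riemannThetaChar_zero {g : ℕ} {Ω : Matrix (Fin g) (Fin g) ℂ}
    (hΩpos : (Matrix.of fun i j => (Ω i j).im : Matrix (Fin g) (Fin g) ℝ).PosDef)
    (z : Fin g → ℂ) : DifferentiableAt ℂ (riemannThetaChar Ω 0 0) z := by
  obtain ⟨t, ht0, ht⟩ := hΩpos.exists_mul_sum_sq_le
  let R : ℝ := ‖z‖ + 1
  let b (S : ℝ) (k : ℤ) : ℝ := Real.exp (-Real.pi * (t * (k : ℝ) ^ 2 - 2 * S * |(k : ℝ)|))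
  have hsum (S : ℝ) : Summable fun n : Fin g → ℤ => ∏ i, b S (n i) :=
    summable_prod_apply_of_nonneg
      (by simpa [b] using summable_pow_mul_jacobiTheta₂_term_bound S ht0 0)
      fun k => (Real.exp_pos _).le
  let L (n : Fin g → ℤ) : (Fin g → ℂ) →L[ℂ] ℂ :=
    (2 * (Real.pi : ℂ) * Complex.I) •
      ∑ i, (n i : ℂ) • (ContinuousLinearMap.proj i : (Fin g → ℂ) →L[ℂ] ℂ)
  have hL (n : Fin g → ℤ) (w : Fin g → ℂ) :
      L n w = 2 * (Real.pi : ℂ) * Complex.I * ((fun i => (n i : ℂ)) ⬝ᵥ w) := by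
    simp [L, dotProduct]
  let q (n : Fin g → ℤ) : ℂ := (Real.pi : ℂ) * Complex.I *
    ((fun i => (n i : ℂ)) ⬝ᵥ Ω.mulVec (fun i => (n i : ℂ)))
  have hbound (n : Fin g → ℤ) {w : Fin g → ℂ} (hw : ‖w‖ ≤ R) :
      ‖Complex.exp (q n + L n w)‖ ≤ ∏ i, b R (n i) := by
    rw [hL]
    exact norm_exp_riemannTheta_term_le ht n hw
  have hLnorm (n : Fin g → ℤ) : ‖L n‖ ≤ ∏ i, Real.exp (2 * Real.pi * |(n i : ℝ)|) := by
    rw [← Real.exp_sum, ← Finset.mul_sum]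
    refine le_trans ?_ ((Real.add_one_le_exp _).trans' (le_add_of_nonneg_right zero_le_one))
    refine (L n).opNorm_le_bound (by positivity) fun w => ?_
    rw [hL, norm_mul, Finset.mul_sum, Finset.sum_mul]
    have hc : ‖2 * (Real.pi : ℂ) * Complex.I‖ = 2 * Real.pi := by
      simp [abs_of_pos Real.pi_pos]
    rw [hc, dotProduct]
    refine (mul_le_mul_of_nonneg_left (norm_sum_le _ _) (by positivity)).trans ?_
    rw [Finset.mul_sum]
    refine Finset.sum_le_sum fun i _ => ?_
    rw [norm_mul, Complex.norm_intCast, mul_assoc (2 * Real.pi)]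
    gcongr
    exact norm_le_pi_norm w i
  have hθ : riemannThetaChar Ω 0 0 = fun w => ∑' n, Complex.exp (q n + L n w) := by
    ext w
    simp [riemannThetaChar, hL, q]
  rw [hθ]
  refine (hasFDerivAt_tsum_of_isPreconnected (hsum (R + 1)) (Metric.isOpen_ball (x := 0) (ε := R))
    (convex_ball _ _).isPreconnected
    (f' := fun n w => Complex.exp (q n + L n w) • L n)
    (fun n w _ => ((L n).hasFDerivAt.const_add _).cexp) (fun n w hw => ?_)
    (x₀ := 0) (Metric.mem_ball_self (by positivity)) ?_ ?_).differentiableAt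
  · have hw' : ‖w‖ ≤ R := (mem_ball_zero_iff.1 hw).le
    rw [norm_smul]
    calc _ ≤ _ := mul_le_mul (hbound n hw') (hLnorm n) (norm_nonneg _)
          (Finset.prod_nonneg fun i _ => (Real.exp_pos _).le)
      _ = _ := by
        rw [← Finset.prod_mul_distrib]
        refine Finset.prod_congr rfl fun i _ => ?_
        rw [← Real.exp_add]
        congr 1
        ring
  · exact (hsum R).of_norm_bounded fun n => hbound n (by simpa using by positivity)
  · simp [R]

/-- The logarithmic derivatives of theta are quasi-periodic with additive factors. -/
theorem zetaTheta_add_period {g : ℕ} {Ω : Matrix (Fin g) (Fin g) ℂ} (hΩ : Ω.IsSymm)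
    (hΩpos : (Matrix.of fun i j => (Ω i j).im : Matrix (Fin g) (Fin g) ℝ).PosDef)
    (m n : Fin g → ℤ) {z : Fin g → ℂ} (hz : riemannThetaChar Ω 0 0 z ≠ 0) (j : Fin g) :
    zetaTheta Ω j (fun i => z i + (m i : ℂ) + Ω.mulVec (fun l => (n l : ℂ)) i) =
      zetaTheta Ω j z - 2 * (Real.pi : ℂ) * Complex.I * (n j : ℂ) := by
  set p : Fin g → ℂ := fun i => (m i : ℂ) + Ω.mulVec (fun l => (n l : ℂ)) i with hp
  have hadd (w : Fin g → ℂ) :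
      (fun i => w i + (m i : ℂ) + Ω.mulVec (fun l => (n l : ℂ)) i) = w + p := by
    ext i
    simp [hp, add_assoc]
  let L : (Fin g → ℂ) →L[ℂ] ℂ := (2 * (Real.pi : ℂ) * Complex.I) •
    ∑ i, (n i : ℂ) • (ContinuousLinearMap.proj i : (Fin g → ℂ) →L[ℂ] ℂ)
  have hL (w : Fin g → ℂ) :
      L w = 2 * (Real.pi : ℂ) * Complex.I * ((fun i => (n i : ℂ)) ⬝ᵥ w) := by
    simp [L, dotProduct]
  set C : ℂ := -((Real.pi : ℂ) * Complex.I *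
    ((fun i => (n i : ℂ)) ⬝ᵥ Ω.mulVec fun i => (n i : ℂ))) with hC
  have hper (w : Fin g → ℂ) : riemannThetaChar Ω 0 0 (w + p) =
      Complex.exp (C - L w) * riemannThetaChar Ω 0 0 w := by
    rw [← hadd, riemannThetaChar_add_period hΩ, hL, hC]
    congr 2
    simp [dotProduct]
  have hd := differentiableAt_riemannThetaChar_zero hΩpos z
  have hfd : HasFDerivAt (fun w => riemannThetaChar Ω 0 0 (w + p))
      (Complex.exp (C - L z) • fderiv ℂ (riemannThetaChar Ω 0 0) z +
        riemannThetaChar Ω 0 0 z • (Complex.exp (C - L z) • -L)) z := by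
    rw [funext hper]
    exact (L.hasFDerivAt.const_sub C).cexp.mul hd.hasFDerivAt
  have hfd' := hfd.fderiv
  rw [fderiv_comp_add_right] at hfd'
  rw [hadd, zetaTheta, zetaTheta, hfd', hper]
  have hLj : L (Pi.single j 1) = 2 * (Real.pi : ℂ) * Complex.I * (n j : ℂ) := by
    rw [hL, dotProduct_single_one]
  have he := Complex.exp_ne_zero (C - L z)
  simp only [_root_.add_apply, _root_.smul_apply,
    _root_.neg_apply, hLj, smul_eq_mul]
  field_simp
  ring

/-- Quasi-periodicity of `f_{N,a}`. -/
theorem fTheta_add_period {g : ℕ} {Ω : Matrix (Fin g) (Fin g) ℂ} (hΩ : Ω.IsSymm) {N : ℕ}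
    (hN : N ≠ 0) (a m n : Fin g → ℤ) (z : Fin g → ℂ) :
    fTheta Ω N a (fun i => z i + (m i : ℂ) + Ω.mulVec (fun l => (n l : ℂ)) i) =
      Complex.exp (N * (-((Real.pi : ℂ) * Complex.I *
          ((fun i => (n i : ℂ)) ⬝ᵥ Ω.mulVec fun i => (n i : ℂ))) -
        2 * (Real.pi : ℂ) * Complex.I * ((fun i => (n i : ℂ)) ⬝ᵥ z))) * fTheta Ω N a z := by
  have hN' : (N : ℂ) ≠ 0 := Nat.cast_ne_zero.2 hN
  have harg : (fun i => (N : ℂ) * (z i + (m i : ℂ) + Ω.mulVec (fun l => (n l : ℂ)) i)) =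
      fun i => (N : ℂ) * z i + (((N : ℤ) * m i : ℤ) : ℂ) +
        ((N : ℂ) • Ω).mulVec (fun l => (n l : ℂ)) i := by
    ext i
    simp [smul_mulVec]
    ring
  have ham : ((fun i => (((a i : ℝ) / (N : ℝ) : ℝ) : ℂ)) ⬝ᵥ
      fun i => (((N : ℤ) * m i : ℤ) : ℂ)) =
      (fun i => (a i : ℂ)) ⬝ᵥ fun i => (m i : ℂ) := by
    refine Finset.sum_congr rfl fun i _ => ?_
    push_cast
    field_simp
  have hzN : (fun i => (N : ℂ) * z i) = (N : ℂ) • z := rfl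
  rw [fTheta, harg, riemannThetaChar_add_period (hΩ.smul _) _ (fun i => (N : ℤ) * m i), ham,
    sub_sub, Complex.exp_sub, exp_two_pi_I_mul_intCast_dotProduct, one_div, ← Complex.exp_neg,
    fTheta, smul_mulVec, hzN, dotProduct_smul, dotProduct_smul, smul_eq_mul, smul_eq_mul]
  congr 2
  ring

/-- The Baker–Akhiezer function
`ψ(z) = [f_{N,a}(z + (c+x)/N) / θ(z)^N] · exp(−∑_{i=1}^g x_i ζ_i(z))`
satisfies `ψ(z + m + Ωn) = exp(−2πi nᵀc) ψ(z)` for all `m, n ∈ ℤ^g` and all `z`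
with `θ(z) ≠ 0`, independently of the deformation parameters `x`. -/
theorem bakerAkhiezer_multiplier (g : ℕ) (hg : 1 ≤ g)
    (Ω : Matrix (Fin g) (Fin g) ℂ) (hΩsymm : Ω.IsSymm)
    (hΩpos : (Matrix.of fun i j => (Ω i j).im : Matrix (Fin g) (Fin g) ℝ).PosDef)
    (N : ℕ) (hN : 1 ≤ N) (a : Fin g → ℤ) (c x : Fin g → ℂ)
    (ψ : (Fin g → ℂ) → ℂ)
    (hψ : ∀ z : Fin g → ℂ,
      ψ z = fTheta Ω N a (fun i => z i + (c i + x i) / (N : ℂ)) /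
          (riemannThetaChar Ω 0 0 z) ^ N *
        Complex.exp (-(∑ i : Fin g, x i * zetaTheta Ω i z)))
    (m n : Fin g → ℤ) (z : Fin g → ℂ) (hz : riemannThetaChar Ω 0 0 z ≠ 0) :
    ψ (fun i => z i + (m i : ℂ) + Ω.mulVec (fun l => (n l : ℂ)) i) =
      Complex.exp (-(2 * (Real.pi : ℂ) * Complex.I *
        ((fun i => (n i : ℂ)) ⬝ᵥ c))) * ψ z := by
  have hN0 : N ≠ 0 := Nat.one_le_iff_ne_zero.1 hN
  have hN' : (N : ℂ) ≠ 0 := Nat.cast_ne_zero.2 hN0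
  set v : Fin g → ℂ := fun i => (n i : ℂ) with hv
  set E : ℂ := -((Real.pi : ℂ) * Complex.I * (v ⬝ᵥ Ω.mulVec v)) -
    2 * (Real.pi : ℂ) * Complex.I * (v ⬝ᵥ z) with hE
  have hθ : riemannThetaChar Ω 0 0 (fun i => z i + (m i : ℂ) + Ω.mulVec v i) =
      Complex.exp E * riemannThetaChar Ω 0 0 z := by
    rw [riemannThetaChar_add_period hΩsymm]
    congr 2
    simp [dotProduct, hE, hv]
  have hshift : (fun i => z i + (m i : ℂ) + Ω.mulVec v i + (c i + x i) / (N : ℂ)) =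
      fun i => (z i + (c i + x i) / (N : ℂ)) + (m i : ℂ) + Ω.mulVec v i := by
    ext i
    ring
  have hzeta : ∑ i, x i * zetaTheta Ω i (fun i => z i + (m i : ℂ) + Ω.mulVec v i) =
      ∑ i, x i * zetaTheta Ω i z - 2 * (Real.pi : ℂ) * Complex.I * (v ⬝ᵥ x) := by
    rw [dotProduct, Finset.mul_sum, ← Finset.sum_sub_distrib]
    refine Finset.sum_congr rfl fun i _ => ?_
    rw [zetaTheta_add_period hΩsymm hΩpos m n hz]
    ring
  have hdot : v ⬝ᵥ (fun i => z i + (c i + x i) / (N : ℂ)) =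
      v ⬝ᵥ z + (v ⬝ᵥ c + v ⬝ᵥ x) / N := by
    simp only [dotProduct, ← Finset.sum_add_distrib, Finset.sum_div]
    refine Finset.sum_congr rfl fun i _ => ?_
    ring
  have hf : Complex.exp (N * (-((Real.pi : ℂ) * Complex.I * (v ⬝ᵥ Ω.mulVec v)) -
      2 * (Real.pi : ℂ) * Complex.I * (v ⬝ᵥ fun i => z i + (c i + x i) / (N : ℂ)))) =
      Complex.exp E ^ N * (Complex.exp (-(2 * (Real.pi : ℂ) * Complex.I * (v ⬝ᵥ c))) *
        Complex.exp (-(2 * (Real.pi : ℂ) * Complex.I * (v ⬝ᵥ x)))) := by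
    rw [← Complex.exp_nat_mul, ← Complex.exp_add, ← Complex.exp_add, hdot, hE]
    congr 1
    field_simp
    ring
  have hcancel : Complex.exp (-(2 * (Real.pi : ℂ) * Complex.I * (v ⬝ᵥ x))) *
      Complex.exp (2 * (Real.pi : ℂ) * Complex.I * (v ⬝ᵥ x)) = 1 := by
    rw [← Complex.exp_add, neg_add_cancel, Complex.exp_zero]
  have hEN := pow_ne_zero N (Complex.exp_ne_zero E)
  rw [hψ, hψ, hshift, fTheta_add_period hΩsymm hN0, hf, hθ, hzeta, mul_pow, neg_sub, sub_eq_add_neg,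
    Complex.exp_add, mul_assoc (Complex.exp E ^ N), mul_div_mul_left _ _ hEN]
  linear_combination (Complex.exp (-(2 * (Real.pi : ℂ) * Complex.I * (v ⬝ᵥ c))) *
    (fTheta Ω N a (fun i => z i + (c i + x i) / (N : ℂ)) / riemannThetaChar Ω 0 0 z ^ N) *
    Complex.exp (-∑ i, x i * zetaTheta Ω i z)) * hcancel
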